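/- Let V be a finite-dimensional real inner product space splitting orthogonally as V = V₁ ⊕ V₂ ⊕ V₃, and let A : Λ²V → Λ²V be a self-adjoint linear map such that each space Vᵢ∧Vⱼ (i,j ∈ {1,2,3}) is an eigenspace of A with eigenvalue λᵢⱼ (= λⱼᵢ). Suppose that for every i ∈ {1,2,3} and all nonnegative integers n₁,n₂,n₃ with nⱼ ≤ dim Vⱼ for j ≠ i, nᵢ ≤ dim Vᵢ − 1, and n₁+n₂+n₃ = k, one has n₁λᵢ₁ + n₂λᵢ₂ + n₃λᵢ₃ > 0. Then for every orthonormal (k+1)-tuple (v₀,v₁,…,v_k) in V, Σ_{i=1}^{k} ⟨A(v₀∧vᵢ), v₀∧vᵢ⟩ > 0. -/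

import Mathlib

open scoped RealInnerProductSpace

/-- An integral point of a box with prescribed coordinate sum. -/
lemma exists_nat_le_sum_eq {ι : Type*} [Fintype ι] (D : ι → ℕ) (k : ℕ) (hk : k ≤ ∑ j, D j) :
    ∃ n : ι → ℕ, (∀ j, n j ≤ D j) ∧ ∑ j, n j = k := by
  classical
  induction k with
  | zero => exact ⟨fun _ => 0, fun _ => Nat.zero_le _, by simp⟩
  | succ k ih =>
    obtain ⟨n, hn, hs⟩ := ih (by omega)
    obtain ⟨j, -, hj⟩ : ∃ j ∈ Finset.univ, n j < D j :=
      Finset.exists_lt_of_sum_lt (by omega)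
    refine ⟨n + Pi.single j 1, fun i => ?_, ?_⟩
    · rcases eq_or_ne i j with rfl | hi
      · simpa using hj
      · simpa [hi] using hn i
    · simp [Finset.sum_add_distrib, hs]

/-- A linear functional positive at the integral points of `{0 ≤ x ≤ D, ∑ x = k}` is positive
on this polytope. -/
lemma sum_mul_pos_of_forall_nat {ι : Type*} [Fintype ι] (c : ι → ℝ) (D : ι → ℕ) (k : ℕ)
    (hk : 1 ≤ k)
    (h : ∀ n : ι → ℕ, (∀ j, n j ≤ D j) → ∑ j, n j = k → 0 < ∑ j, (n j : ℝ) * c j)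
    (x : ι → ℝ) (hx0 : ∀ j, 0 ≤ x j) (hxD : ∀ j, x j ≤ D j) (hxk : ∑ j, x j = k) :
    0 < ∑ j, x j * c j := by
  classical
  have hkD : k ≤ ∑ j, D j := by
    have : (k : ℝ) ≤ ∑ j, (D j : ℝ) := hxk ▸ Finset.sum_le_sum fun j _ => hxD j
    exact_mod_cast this
  have hfin : {n : ι → ℕ | (∀ j, n j ≤ D j) ∧ ∑ j, n j = k}.Finite :=
    (Set.finite_Iic D).subset fun n hn => hn.1
  obtain ⟨n, ⟨hnD, hnk⟩, hmin⟩ := Set.exists_min_image _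
    (fun n : ι → ℕ => ∑ j, (n j : ℝ) * c j) hfin (exists_nat_le_sum_eq D k hkD)
  have hexch : ∀ p q, 0 < n p → n q < D q → c p ≤ c q := by
    intro p q hp hq
    rcases eq_or_ne p q with rfl | hpq
    · exact le_rfl
    have hsplit : n = (n - Pi.single p 1) + Pi.single p 1 := by
      ext i
      rcases eq_or_ne i p with rfl | hi
      · simp; omega
      · simp [hi]
    set n₀ : ι → ℕ := n - Pi.single p 1 with hn₀
    have hsum₀ : ∑ j, n₀ j + 1 = k := by
      rw [← hnk]; conv_rhs => rw [hsplit]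
      simp [Finset.sum_add_distrib]
    have hle := hmin (n₀ + Pi.single q 1) ⟨fun i => ?_, by
      simpa [Finset.sum_add_distrib] using hsum₀⟩
    · rw [hsplit] at hle
      simp only [Pi.add_apply, Nat.cast_add, add_mul, Finset.sum_add_distrib] at hle
      simpa [Pi.single_apply] using hle
    · rcases eq_or_ne i q with rfl | hi
      · simp [hn₀, hpq.symm]; omega
      · simpa [hn₀, hi] using le_trans (Nat.sub_le _ _) (hnD i)
  obtain ⟨p₀, -, hp₀⟩ : ∃ j ∈ Finset.univ, 0 < n j := by
    by_contra! hcon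
    have : ∑ j, n j ≤ ∑ _j : ι, 0 := Finset.sum_le_sum hcon
    rw [Finset.sum_const_zero] at this
    omega
  obtain ⟨p, hp, hpmax⟩ := Finset.exists_max_image (Finset.univ.filter fun j => 0 < n j) c
    ⟨p₀, by simpa using hp₀⟩
  have hp' : 0 < n p := by simpa using hp
  have hterm : ∀ j, (x j - n j) * c p ≤ (x j - n j) * c j := by
    intro j
    rcases lt_trichotomy (x j) (n j) with hlt | heq | hgt
    · have hnj : 0 < n j := by
        have : (0 : ℝ) < n j := (hx0 j).trans_lt hlt
        exact_mod_cast this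
      exact mul_le_mul_of_nonpos_left (hpmax j (by simpa using hnj)) (by linarith)
    · simp [heq]
    · have hnj : n j < D j := by
        have : (n j : ℝ) < D j := hgt.trans_le (hxD j)
        exact_mod_cast this
      exact mul_le_mul_of_nonneg_left (hexch p j hp' hnj) (by linarith)
  have hsum := Finset.sum_le_sum fun j (_ : j ∈ Finset.univ) => hterm j
  have hnk' : ∑ j, (n j : ℝ) = k := by exact_mod_cast hnk
  rw [← Finset.sum_mul, Finset.sum_sub_distrib, hxk, hnk'] at hsum
  simp only [sub_mul, Finset.sum_sub_distrib] at hsum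
  linarith [h n hnD hnk]

/-- A symmetric `3 × 3` array of off-diagonal weights `σ` splits as `K i j + K j i`, where the
`i`-th row of `K` has sum `a i * τ` and entries in `[0, a i]`. -/
lemma exists_split_rows (a m : Fin 3 → ℝ) (c : Fin 3 → Fin 3 → ℝ)
    (ha : ∀ i, 0 ≤ a i) (ha1 : ∑ i, a i = 1)
    (hc : ∀ i j, c i j = c j i) (hcsum : ∀ i, ∑ j, c i j = 0) (hcdiag : ∀ i, c i i = a i * m i)
    (hm0 : ∀ i, 0 ≤ m i) (hm1 : ∀ i, m i ≤ 1 - a i)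
    (hσ0 : ∀ i j, i ≠ j → 0 ≤ a i * m j + a j * m i - 2 * c i j)
    (hσ1 : ∀ i j, i ≠ j → a i * m j + a j * m i - 2 * c i j ≤ a i + a j) :
    ∃ K : Fin 3 → Fin 3 → ℝ, (∀ i, K i i = 0) ∧ (∀ i j, 0 ≤ K i j) ∧ (∀ i j, K i j ≤ a i) ∧
      (∀ i, ∑ j, K i j = a i * ∑ j, m j) ∧
      ∀ i j, i ≠ j → K i j + K j i = a i * m j + a j * m i - 2 * c i j := by
  simp only [Fin.sum_univ_three] at ha1 hcsum ⊢
  set τ := m 0 + m 1 + m 2 with hτ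
  obtain ⟨s0, hs0⟩ : ∃ s, s = a 1 * m 2 + a 2 * m 1 - 2 * c 1 2 := ⟨_, rfl⟩
  obtain ⟨s1, hs1⟩ : ∃ s, s = a 0 * m 2 + a 2 * m 0 - 2 * c 0 2 := ⟨_, rfl⟩
  obtain ⟨s2, hs2⟩ : ∃ s, s = a 0 * m 1 + a 1 * m 0 - 2 * c 0 1 := ⟨_, rfl⟩
  have e0 := hcsum 0
  have e1 := hcsum 1
  have e2 := hcsum 2
  rw [hc 1 0] at e1
  rw [hc 2 0, hc 2 1] at e2
  rw [hcdiag] at e0 e1 e2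
  have t0 : s0 = (a 1 * τ + a 2 * τ) - m 0 := by
    linear_combination hs0 + e0 - e1 - e2 - m 0 * ha1
  have t1 : s1 = (a 0 * τ + a 2 * τ) - m 1 := by
    linear_combination hs1 + e1 - e0 - e2 - m 1 * ha1
  have t2 : s2 = (a 0 * τ + a 1 * τ) - m 2 := by
    linear_combination hs2 + e2 - e0 - e1 - m 2 * ha1
  have hτa : a 0 * τ + a 1 * τ + a 2 * τ = τ := by linear_combination τ * ha1
  have p0 := hσ0 1 2 (by decide)
  have p1 := hσ0 0 2 (by decide)
  have p2 := hσ0 0 1 (by decide)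
  have q0 := hσ1 1 2 (by decide)
  have q1 := hσ1 0 2 (by decide)
  have q2 := hσ1 0 1 (by decide)
  rw [← hs0] at p0 q0
  rw [← hs1] at p1 q1
  rw [← hs2] at p2 q2
  have hm00 := hm0 0
  have hm01 := hm0 1
  have hm02 := hm0 2
  have hm10 := hm1 0
  have hm11 := hm1 1
  have hm12 := hm1 2
  have hτ0 : 0 ≤ τ := by linarith
  have A0 := ha 0
  have A1 := ha 1
  have A2 := ha 2
  have b0 := mul_nonneg A0 hτ0
  have b1 := mul_nonneg A1 hτ0
  have b2 := mul_nonneg A2 hτ0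
  have hτ2 : τ ≤ 2 := by linarith
  have d0 := mul_le_mul_of_nonneg_left hτ2 A0
  have d1 := mul_le_mul_of_nonneg_left hτ2 A1
  have d2 := mul_le_mul_of_nonneg_left hτ2 A2
  obtain ⟨θ, l1, l2, l3, l4, l5, l6, u1, u2, u3, u4, u5, u6⟩ : ∃ θ : ℝ,
      0 ≤ θ ∧ a 0 * τ - a 0 ≤ θ ∧ s2 - a 1 ≤ θ ∧ s2 - a 1 * τ ≤ θ ∧ a 0 * τ - s1 ≤ θ ∧
      a 0 * τ - s1 + a 2 * τ - a 2 ≤ θ ∧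
      θ ≤ a 0 ∧ θ ≤ a 0 * τ ∧ θ ≤ s2 ∧ θ ≤ s2 - a 1 * τ + a 1 ∧ θ ≤ a 0 * τ - s1 + a 2 ∧
      θ ≤ a 0 * τ - s1 + a 2 * τ := by
    refine ⟨max 0 (max (a 0 * τ - a 0) (max (s2 - a 1) (max (s2 - a 1 * τ)
      (max (a 0 * τ - s1) (a 0 * τ - s1 + a 2 * τ - a 2))))), ?_⟩
    simp only [le_max_iff, max_le_iff, le_refl, true_or, or_true, true_and]
    rcases le_total τ 1 with h1 | h1
    · have f0 := mul_le_mul_of_nonneg_left h1 A0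
      have f1 := mul_le_mul_of_nonneg_left h1 A1
      have f2 := mul_le_mul_of_nonneg_left h1 A2
      refine ⟨?_, ?_, ?_, ?_, ?_, ?_⟩ <;> refine ⟨?_, ?_, ?_, ?_, ?_, ?_⟩ <;> linarith
    · have f0 := mul_le_mul_of_nonneg_left h1 A0
      have f1 := mul_le_mul_of_nonneg_left h1 A1
      have f2 := mul_le_mul_of_nonneg_left h1 A2
      refine ⟨?_, ?_, ?_, ?_, ?_, ?_⟩ <;> refine ⟨?_, ?_, ?_, ?_, ?_, ?_⟩ <;> linarith
  refine ⟨![![0, θ, a 0 * τ - θ], ![s2 - θ, 0, a 1 * τ - s2 + θ],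
    ![s1 - a 0 * τ + θ, a 2 * τ - s1 + a 0 * τ - θ, 0]], ?_, ?_, ?_, ?_, ?_⟩
  · intro i; fin_cases i <;> simp
  · intro i j; fin_cases i <;> fin_cases j <;> simp <;> linarith
  · intro i j; fin_cases i <;> fin_cases j <;> simp <;> linarith
  · intro i; fin_cases i <;> simp
  · intro i j hij
    fin_cases i <;> fin_cases j <;> simp at hij ⊢
    · linarith
    · linarith
    · linarith [hc 1 0]
    · linarith
    · linarith [hc 2 0]
    · linarith [hc 2 1]

/-- Bessel's inequality summed over an orthonormal basis of a subspace `U`; here `y l` is the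
orthogonal projection of `w l` to `U`. -/
lemma Orthonormal.sum_norm_sq_le_finrank {V : Type*} [NormedAddCommGroup V]
    [InnerProductSpace ℝ V] {ι : Type*} [Fintype ι] {w : ι → V} (hw : Orthonormal ℝ w)
    (U : Submodule ℝ V) [FiniteDimensional ℝ U] (y : ι → V) (hy : ∀ l, y l ∈ U)
    (hyw : ∀ l, ∀ b ∈ U, ⟪b, y l⟫ = ⟪b, w l⟫) :
    ∑ l, ‖y l‖ ^ 2 ≤ Module.finrank ℝ U := by
  let b := stdOrthonormalBasis ℝ U
  have h1 : ∀ l, ‖y l‖ ^ 2 = ∑ p, ⟪(b p : V), w l⟫ ^ 2 := by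
    intro l
    have := b.sum_sq_norm_inner_right (⟨y l, hy l⟩ : U)
    simp only [Submodule.coe_inner, Real.norm_eq_abs, sq_abs, Submodule.coe_norm] at this
    rw [← this]
    exact Finset.sum_congr rfl fun p _ => by rw [hyw l _ (b p).2]
  have h2 : ∀ p, ∑ l, ⟪(b p : V), w l⟫ ^ 2 ≤ 1 := by
    intro p
    have := hw.sum_inner_products_le (b p : V) (s := Finset.univ)
    have hb : ‖(b p : V)‖ = 1 := b.orthonormal.1 p
    simp only [Real.norm_eq_abs, sq_abs, hb, one_pow] at this
    simpa only [real_inner_comm] using this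
  calc ∑ l, ‖y l‖ ^ 2 = ∑ p, ∑ l, ⟪(b p : V), w l⟫ ^ 2 := by
        simp_rw [h1]; exact Finset.sum_comm
    _ ≤ ∑ _p : Fin (Module.finrank ℝ U), (1 : ℝ) := Finset.sum_le_sum fun p _ => h2 p
    _ = Module.finrank ℝ U := by simp

/-- Bessel's inequality for a finite real orthonormal family. -/
lemma Orthonormal.sum_inner_sq_le {V : Type*} [NormedAddCommGroup V]
    [InnerProductSpace ℝ V] {ι : Type*} [Fintype ι] {w : ι → V} (hw : Orthonormal ℝ w) (x : V) :
    ∑ l, ⟪w l, x⟫ ^ 2 ≤ ‖x‖ ^ 2 := by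
  simpa only [Real.norm_eq_abs, sq_abs] using hw.sum_inner_products_le x (s := Finset.univ)

/-- If a unit vector `u` of `U` is removed, the bound of `Orthonormal.sum_norm_sq_le_finrank`
drops by one. -/
lemma Orthonormal.sum_norm_sq_sub_inner_sq_le {V : Type*} [NormedAddCommGroup V]
    [InnerProductSpace ℝ V] {ι : Type*} [Fintype ι] {w : ι → V} (hw : Orthonormal ℝ w)
    (U : Submodule ℝ V) [FiniteDimensional ℝ U] (y : ι → V) (hy : ∀ l, y l ∈ U)
    (hyw : ∀ l, ∀ b ∈ U, ⟪b, y l⟫ = ⟪b, w l⟫) (u : V) (hu : u ∈ U) (hu1 : ‖u‖ = 1) :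
    ∑ l, (‖y l‖ ^ 2 - ⟪w l, u⟫ ^ 2) + 1 ≤ Module.finrank ℝ U := by
  have hle : (ℝ ∙ u) ≤ U := by simpa [Submodule.span_singleton_le_iff_mem] using hu
  have hfr := Submodule.finrank_add_inf_finrank_orthogonal hle
  rw [finrank_span_singleton (by rintro rfl; simp at hu1)] at hfr
  have huu : ⟪u, u⟫ = 1 := by rw [real_inner_self_eq_norm_sq, hu1, one_pow]
  have : FiniteDimensional ℝ ↥((ℝ ∙ u)ᗮ ⊓ U) :=
    Submodule.finiteDimensional_of_le inf_le_right
  have key := hw.sum_norm_sq_le_finrank ((ℝ ∙ u)ᗮ ⊓ U) (fun l => y l - ⟪u, y l⟫ • u)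
    (fun l => ⟨?_, U.sub_mem (hy l) (U.smul_mem _ hu)⟩) ?_
  · have hn : ∀ l, ‖y l - ⟪u, y l⟫ • u‖ ^ 2 = ‖y l‖ ^ 2 - ⟪w l, u⟫ ^ 2 := by
      intro l
      rw [norm_sub_sq_real, norm_smul, hu1, real_inner_smul_right, real_inner_comm u (y l),
        hyw l u hu, real_inner_comm u (w l), Real.norm_eq_abs, mul_one, sq_abs]
      ring
    simp only [hn] at key
    rw [← hfr]
    push_cast
    linarith
  · rw [SetLike.mem_coe, Submodule.mem_orthogonal_singleton_iff_inner_right, inner_sub_right,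
      real_inner_smul_right, huu]
    ring
  · rintro l b ⟨hb1, hb2⟩
    rw [SetLike.mem_coe, Submodule.mem_orthogonal_singleton_iff_inner_left] at hb1
    rw [inner_sub_right, real_inner_smul_right, hb1, hyw l b hb2]
    ring

/-- Proposition 2.4: if `V = V₁ ⊕ V₂ ⊕ V₃` orthogonally and a self-adjoint `A` on `Λ²V`
(encoded via a wedge map) has each `Vᵢ∧Vⱼ` as an eigenspace with eigenvalue `λᵢⱼ`, and
all the eigenvalue sums `n₁λᵢ₁ + n₂λᵢ₂ + n₃λᵢ₃` (with `n₁+n₂+n₃ = k`, `nⱼ ≤ dim Vⱼ`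
for `j ≠ i`, `nᵢ ≤ dim Vᵢ − 1`) are positive, then the value of `A` on every `k`-chain
is positive. -/
theorem value_positive_on_k_chains {V W : Type*}
    [NormedAddCommGroup V] [InnerProductSpace ℝ V] [FiniteDimensional ℝ V]
    [NormedAddCommGroup W] [InnerProductSpace ℝ W]
    (wedge : V →ₗ[ℝ] V →ₗ[ℝ] W)
    (hinner : ∀ a b c d : V, ⟪wedge a b, wedge c d⟫
      = ⟪a, c⟫ * ⟪b, d⟫ - ⟪a, d⟫ * ⟪b, c⟫)
    (hspan : Submodule.span ℝ {x : W | ∃ a b : V, wedge a b = x} = ⊤)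
    (A : W →ₗ[ℝ] W) (hA : A.IsSymmetric)
    (Vsub : Fin 3 → Submodule ℝ V)
    (horth : ∀ i j : Fin 3, i ≠ j → ∀ x ∈ Vsub i, ∀ y ∈ Vsub j, ⟪x, y⟫ = 0)
    (hsup : Vsub 0 ⊔ Vsub 1 ⊔ Vsub 2 = ⊤)
    (lam : Fin 3 → Fin 3 → ℝ) (hlam : ∀ i j, lam i j = lam j i)
    (heigen : ∀ i j : Fin 3, ∀ x ∈ Vsub i, ∀ y ∈ Vsub j,
      A (wedge x y) = lam i j • wedge x y)
    (k : ℕ) (hk1 : 1 ≤ k) (hk2 : k + 1 ≤ Module.finrank ℝ V)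
    (hsums : ∀ i : Fin 3, ∀ n : Fin 3 → ℕ,
      (∀ j, j ≠ i → n j ≤ Module.finrank ℝ (Vsub j)) →
      n i < Module.finrank ℝ (Vsub i) →
      ∑ j, n j = k →
      0 < ∑ j, (n j : ℝ) * lam i j) :
    ∀ (v₀ : V) (w : Fin k → V),
      Orthonormal ℝ (Fin.cons v₀ w : Fin (k+1) → V) →
      0 < ∑ i, ⟪A (wedge v₀ (w i)), wedge v₀ (w i)⟫ := by
  intro v₀ w hon
  have hdec : ∀ v : V, ∃ x : Fin 3 → V, (∀ i, x i ∈ Vsub i) ∧ ∑ i, x i = v := by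
    intro v
    have hv : v ∈ Vsub 0 ⊔ Vsub 1 ⊔ Vsub 2 := hsup ▸ Submodule.mem_top
    obtain ⟨y, hy, z, hz, rfl⟩ := Submodule.mem_sup.1 hv
    obtain ⟨x, hx, y, hy, rfl⟩ := Submodule.mem_sup.1 hy
    refine ⟨![x, y, z], fun i => ?_, by simp [Fin.sum_univ_three]⟩
    fin_cases i <;> simpa
  choose comp hmem hsum using hdec
  have hproj : ∀ v i, ∀ b ∈ Vsub i, ⟪b, comp v i⟫ = ⟪b, v⟫ := by
    intro v i b hb
    conv_rhs => rw [← hsum v]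
    rw [inner_sum, Finset.sum_eq_single i]
    · exact fun j _ hj => horth i j hj.symm b hb _ (hmem v j)
    · simp
  have hw : Orthonormal ℝ w := by
    simpa [Function.comp_def] using hon.comp Fin.succ (Fin.succ_injective k)
  have hv₀ : ‖v₀‖ = 1 := by simpa using hon.1 0
  obtain ⟨x, hx⟩ : ∃ x, x = comp v₀ := ⟨_, rfl⟩
  have hxmem : ∀ i, x i ∈ Vsub i := fun i => hx ▸ hmem v₀ i
  have hxv : ∀ i, ⟪x i, v₀⟫ = ‖x i‖ ^ 2 := fun i => by
    rw [← hproj v₀ i _ (hxmem i), ← hx, real_inner_self_eq_norm_sq]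
  have hxsum : ∑ i, x i = v₀ := hx ▸ hsum v₀
  have hform : ∀ z, ⟪A (wedge v₀ z), wedge v₀ z⟫ =
      ∑ i, ∑ j, lam i j * (‖x i‖ ^ 2 * ‖comp z j‖ ^ 2 - ⟪z, x i⟫ * ⟪z, x j⟫) := by
    intro z
    have hAz : A (wedge v₀ z) = ∑ i, ∑ j, lam i j • wedge (x i) (comp z j) := by
      conv_lhs => rw [← hxsum, ← hsum z]
      simp only [map_sum, LinearMap.sum_apply]
      rw [Finset.sum_comm]
      exact Finset.sum_congr rfl fun i _ => Finset.sum_congr rfl fun j _ =>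
        heigen i j _ (hxmem i) _ (hmem z j)
    rw [hAz]
    simp only [sum_inner, real_inner_smul_left, hinner]
    refine Finset.sum_congr rfl fun i _ => Finset.sum_congr rfl fun j _ => ?_
    rw [hxv, ← hproj z j _ (hmem z j), real_inner_self_eq_norm_sq,
      ← hproj v₀ j _ (hmem z j), ← hx, real_inner_comm (x j) (comp z j),
      hproj z j _ (hxmem j), real_inner_comm z, real_inner_comm z]
  -- `u i` is the normalization of `x i`, and `0` if `x i = 0`
  obtain ⟨u, hu⟩ : ∃ u : Fin 3 → V, u = fun i => ‖x i‖⁻¹ • x i := ⟨_, rfl⟩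
  have hxu : ∀ i, x i = ‖x i‖ • u i := by
    intro i
    rcases eq_or_ne (x i) 0 with h | h
    · simp [h]
    · rw [hu]; simp [smul_smul, h]
  have hu0 : ∀ i, x i = 0 → u i = 0 := fun i h => by simp [hu, h]
  have hu1 : ∀ i, x i ≠ 0 → ‖u i‖ = 1 := fun i h => by simp [hu, norm_smul, h]
  have hule : ∀ i, ‖u i‖ ^ 2 ≤ 1 := by
    intro i
    rcases eq_or_ne (x i) 0 with h | h
    · simp [hu0 i h]
    · simp [hu1 i h]
  have humem : ∀ i, u i ∈ Vsub i := fun i => by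
    rw [hu]; exact (Vsub i).smul_mem _ (hxmem i)
  obtain ⟨a, ha⟩ : ∃ a : Fin 3 → ℝ, a = fun i => ‖x i‖ ^ 2 := ⟨_, rfl⟩
  obtain ⟨m, hm⟩ : ∃ m : Fin 3 → ℝ, m = fun i => ∑ l, ⟪w l, u i⟫ ^ 2 := ⟨_, rfl⟩
  obtain ⟨c, hc⟩ : ∃ c : Fin 3 → Fin 3 → ℝ, c = fun i j => ∑ l, ⟪w l, x i⟫ * ⟪w l, x j⟫ :=
    ⟨_, rfl⟩
  obtain ⟨t, ht⟩ : ∃ t : Fin 3 → ℝ, t = fun j => ∑ l, ‖comp (w l) j‖ ^ 2 := ⟨_, rfl⟩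
  have hnormsq : ∀ v, ∑ i, ‖comp v i‖ ^ 2 = ‖v‖ ^ 2 := by
    intro v
    rw [← real_inner_self_eq_norm_sq v]
    conv_rhs => rw [← hsum v, sum_inner, hsum v]
    exact Finset.sum_congr rfl fun i _ => by
      rw [← hproj v i _ (hmem v i), real_inner_self_eq_norm_sq]
  have hwx : ∀ l i, ⟪w l, x i⟫ = ‖x i‖ * ⟪w l, u i⟫ := fun l i => by
    conv_lhs => rw [hxu i, real_inner_smul_right]
  have ha0 : ∀ i, 0 ≤ a i := fun i => by rw [ha]; positivity
  have ha1 : ∑ i, a i = 1 := by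
    rw [ha, hx]; simp only; rw [hnormsq, hv₀, one_pow]
  have hσ : ∀ i j, a i * m j + a j * m i - 2 * c i j =
      ∑ l, ⟪w l, ‖x i‖ • u j - ‖x j‖ • u i⟫ ^ 2 := by
    intro i j
    simp only [ha, hm, hc, Finset.mul_sum, ← Finset.sum_add_distrib, ← Finset.sum_sub_distrib]
    refine Finset.sum_congr rfl fun l _ => ?_
    rw [hwx, hwx, inner_sub_right, real_inner_smul_right, real_inner_smul_right]
    ring
  have hcdiag : ∀ i, c i i = a i * m i := fun i => by
    simp only [hc, ha, hm, Finset.mul_sum, hwx]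
    exact Finset.sum_congr rfl fun l _ => by ring
  have hcsymm : ∀ i j, c i j = c j i := fun i j => by simp only [hc, mul_comm]
  have hm0 : ∀ i, 0 ≤ m i := fun i => by rw [hm]; positivity
  obtain ⟨K, hKdiag, hK0, hKa, hKsum, hKpair⟩ := exists_split_rows a m c ha0 ha1
    hcsymm
    (fun i => by
      have h0 : ∀ l, ⟪w l, v₀⟫ = 0 := fun l => by
        simpa using hon.2 (Fin.succ_ne_zero l)
      simp only [hc]
      rw [Finset.sum_comm]
      refine Finset.sum_eq_zero fun l _ => ?_
      rw [← Finset.mul_sum, ← inner_sum, hxsum, h0, mul_zero])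
    hcdiag hm0
    (fun i => by
      have hb := hon.sum_inner_sq_le (u i)
      have hvu : ⟪v₀, u i⟫ ^ 2 = a i := by
        rcases eq_or_ne (x i) 0 with h | h
        · simp [hu0 i h, ha, h]
        · have : ‖x i‖ ≠ 0 := by simpa using h
          simp only [hu, ha, real_inner_smul_right, real_inner_comm (x i) v₀, hxv]
          field_simp
      rw [Fin.sum_univ_succ] at hb
      simp only [Fin.cons_zero, Fin.cons_succ, hvu] at hb
      have := hule i
      simp only [hm]
      linarith)
    (fun i j _ => by rw [hσ]; positivity)
    (fun i j hij => by
      rw [hσ]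
      refine (hw.sum_inner_sq_le _).trans ?_
      rw [norm_sub_sq_real, real_inner_smul_left, real_inner_smul_right,
        horth j i hij.symm _ (humem j) _ (humem i), norm_smul, norm_smul, mul_pow, mul_pow,
        norm_norm, norm_norm]
      have h1 := mul_le_mul_of_nonneg_left (hule j) (sq_nonneg ‖x i‖)
      have h2 := mul_le_mul_of_nonneg_left (hule i) (sq_nonneg ‖x j‖)
      simp only [ha]
      linarith)
  obtain ⟨n, hn⟩ : ∃ n : Fin 3 → ℝ, n = fun j => t j - m j := ⟨_, rfl⟩
  have hcomp_u : ∀ l j, ⟪w l, u j⟫ = ⟪comp (w l) j, u j⟫ := fun l j => by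
    rw [real_inner_comm, ← hproj (w l) j _ (humem j), real_inner_comm]
  have hn0 : ∀ j, 0 ≤ n j := by
    intro j
    simp only [hn, ht, hm, ← Finset.sum_sub_distrib]
    refine Finset.sum_nonneg fun l _ => ?_
    rw [hcomp_u, sub_nonneg, ← sq_abs]
    refine (pow_le_pow_left₀ (abs_nonneg _) (abs_real_inner_le_norm _ _) 2).trans ?_
    rw [mul_pow]
    exact mul_le_of_le_one_right (sq_nonneg _) (hule j)
  have hnle : ∀ j, n j ≤ Module.finrank ℝ (Vsub j) := by
    intro j
    have := hw.sum_norm_sq_le_finrank (Vsub j) (fun l => comp (w l) j) (fun l => hmem _ j)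
      (fun l b hb => hproj _ j b hb)
    have h' := hm0 j
    simp only [hn, ht]
    linarith
  have hnle' : ∀ j, x j ≠ 0 → n j + 1 ≤ Module.finrank ℝ (Vsub j) := by
    intro j hj
    have := hw.sum_norm_sq_sub_inner_sq_le (Vsub j) (fun l => comp (w l) j)
      (fun l => hmem _ j) (fun l b hb => hproj _ j b hb) (u j) (humem j) (hu1 j hj)
    rw [Finset.sum_sub_distrib] at this
    simpa only [hn, ht, hm] using this
  have hnsum : ∑ j, n j + ∑ j, m j = k := by
    simp only [hn, Finset.sum_sub_distrib, sub_add_cancel, ht]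
    rw [Finset.sum_comm]
    simp [hnormsq, hw.1]
  have htotal : ∑ l, ⟪A (wedge v₀ (w l)), wedge v₀ (w l)⟫ =
      ∑ i, ∑ j, (a i * n j + K i j) * lam i j := by
    have h1 : ∑ l, ⟪A (wedge v₀ (w l)), wedge v₀ (w l)⟫ =
        ∑ i, ∑ j, lam i j * (a i * t j - c i j) := by
      simp only [hform]
      rw [Finset.sum_comm]
      refine Finset.sum_congr rfl fun i _ => ?_
      rw [Finset.sum_comm]
      refine Finset.sum_congr rfl fun j _ => ?_
      simp only [ha, ht, hc, ← Finset.mul_sum, Finset.sum_sub_distrib]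
    rw [h1]
    simp only [Fin.sum_univ_three, hn, hKdiag, hcdiag]
    rw [hlam 1 0, hlam 2 0, hlam 2 1, hcsymm 1 0, hcsymm 2 0, hcsymm 2 1]
    linear_combination -lam 0 1 * hKpair 0 1 (by decide) - lam 0 2 * hKpair 0 2 (by decide)
      - lam 1 2 * hKpair 1 2 (by decide)
  have hKzero : ∀ i j, x j = 0 → K i j = 0 := by
    intro i j hj
    rcases eq_or_ne i j with rfl | hij
    · exact hKdiag i
    have h1 := hKpair i j hij
    have h2 : a j = 0 := by simp [ha, hj]
    rw [hσ, hj, hu0 j hj] at h1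
    simp only [smul_zero, norm_zero, zero_smul, sub_zero, inner_zero_right, ne_eq,
      OfNat.ofNat_ne_zero, not_false_eq_true, zero_pow, Finset.sum_const_zero] at h1
    linarith [hK0 i j, hK0 j i]
  have hrow : ∀ i, 0 < a i → 0 < ∑ j, (a i * n j + K i j) * lam i j := by
    intro i hi
    have hxi : x i ≠ 0 := by rintro h; simp [ha, h] at hi
    have hdi : 1 ≤ Module.finrank ℝ (Vsub i) := by
      have : (1 : ℝ) ≤ Module.finrank ℝ (Vsub i) := by linarith [hnle' i hxi, hn0 i]
      exact_mod_cast this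
    have key := sum_mul_pos_of_forall_nat (lam i)
      (Function.update (fun j => Module.finrank ℝ (Vsub j)) i
        (Module.finrank ℝ (Vsub i) - 1)) k hk1
      (fun q hq hqk => hsums i q
        (fun j hj => by simpa [hj] using hq j)
        (by have := hq i; simp only [Function.update_self] at this; omega) hqk)
      (fun j => n j + K i j / a i)
      (fun j => add_nonneg (hn0 j) (div_nonneg (hK0 i j) hi.le))
      (fun j => by
        rcases eq_or_ne j i with rfl | hj
        · simp only [Function.update_self, hKdiag, zero_div, add_zero, Nat.cast_sub hdi,
            Nat.cast_one]
          linarith [hnle' j hxi]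
        · rw [Function.update_of_ne hj]
          rcases eq_or_ne (x j) 0 with h | h
          · simpa [hKzero i j h] using hnle j
          · have : K i j / a i ≤ 1 := (div_le_one hi).2 (hKa i j)
            linarith [hnle' j h])
      (by
        rw [Finset.sum_add_distrib, ← Finset.sum_div, hKsum, mul_div_cancel_left₀ _ hi.ne',
          hnsum])
    have hscale : ∑ j, (a i * n j + K i j) * lam i j =
        a i * ∑ j, (n j + K i j / a i) * lam i j := by
      rw [Finset.mul_sum]
      refine Finset.sum_congr rfl fun j _ => ?_
      field_simp
    rw [hscale]
    exact mul_pos hi key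
  rw [htotal]
  refine Finset.sum_pos' (fun i _ => ?_) ?_
  · rcases (ha0 i).eq_or_lt with h | h
    · refine (Finset.sum_eq_zero fun j _ => ?_).ge
      have : K i j = 0 := le_antisymm (h ▸ hKa i j) (hK0 i j)
      simp [← h, this]
    · exact (hrow i h).le
  · obtain ⟨i, -, hi⟩ : ∃ i ∈ Finset.univ, 0 < a i := by
      by_contra! hcon
      have := Finset.sum_nonpos hcon
      linarith
    exact ⟨i, Finset.mem_univ i, hrow i hi⟩
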